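/- A primitive sequence S with curling number k is robust if and only if no proper suffix of S^2 has curling number k + 1. -/

import Mathlib

/-- `listPow Y k` is the sequence `Y` repeated `k` times (i.e. `Y^k`). -/
def listPow {α : Type*} (Y : List α) : ℕ → List α
  | 0 => []
  | k + 1 => Y ++ listPow Y k

/-- The curling number of a finite sequence `S`: the largest `k` such that
`S = X ++ Y^k` for some (possibly empty) `X` and nonempty `Y`. -/
noncomputable def CN {α : Type*} (S : List α) : ℕ :=
  sSup {k | ∃ X Y : List α, Y ≠ [] ∧ S = X ++ listPow Y k}

/-- A nonempty sequence is primitive if it is not a power `T^i` with `i ≥ 2`. -/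
def Primitive {α : Type*} (S : List α) : Prop :=
  S ≠ [] ∧ ∀ (T : List α) (i : ℕ), 2 ≤ i → S ≠ listPow T i

/-- `T` is a proper suffix of `S`: a suffix which is strictly shorter than `S`. -/
def ProperSuffix {α : Type*} (T S : List α) : Prop := T <:+ S ∧ T.length < S.length

/-- A sequence `S` with curling number `k` is robust if no proper suffix of
`S^(k+1)` has curling number `≥ k + 1`. -/
def Robust {α : Type*} (S : List α) : Prop :=
  ∀ T : List α, ProperSuffix T (listPow S (CN S + 1)) → CN T ≤ CN S

theorem listPow_add {α : Type*} (Y : List α) (m n : ℕ) :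
    listPow Y (m + n) = listPow Y m ++ listPow Y n := by
  induction m with
  | zero => simp [listPow]
  | succ m ih => rw [Nat.succ_add]; simp [listPow, ih]

theorem listPow_one {α : Type*} (Y : List α) : listPow Y 1 = Y := by
  simp [listPow]

theorem length_listPow {α : Type*} (Y : List α) (n : ℕ) :
    (listPow Y n).length = n * Y.length := by
  induction n with
  | zero => simp [listPow]
  | succ n ih => simp [listPow, ih]; ring

theorem listPow_suffix_listPow {α : Type*} (Y : List α) {m n : ℕ} (h : m ≤ n) :
    listPow Y m <:+ listPow Y n := by
  obtain ⟨d, rfl⟩ := Nat.exists_eq_add_of_le' h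
  exact ⟨listPow Y d, (listPow_add Y d m).symm⟩

/-- Two commuting sequences are powers of a common sequence. -/
theorem exists_listPow_of_append_comm {α : Type*} (x y : List α) (h : x ++ y = y ++ x) :
    ∃ (t : List α) (i j : ℕ), x = listPow t i ∧ y = listPow t j := by
  induction hn : x.length + y.length using Nat.strong_induction_on generalizing x y with
  | _ n ih =>
    wlog hle : x.length ≤ y.length generalizing x y
    · obtain ⟨t, i, j, hy, hx⟩ := this y x h.symm (by omega) (by omega)
      exact ⟨t, j, i, hx, hy⟩
    rcases eq_or_ne x [] with rfl | hx
    · exact ⟨y, 0, 1, rfl, (listPow_one y).symm⟩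
    have hpos := List.length_pos_iff.mpr hx
    obtain ⟨z, rfl⟩ : x <+: y :=
      List.prefix_of_prefix_length_le ⟨y, h⟩ (List.prefix_append y x) hle
    rw [List.append_assoc, List.append_cancel_left_eq] at h
    rw [List.length_append] at hn
    obtain ⟨t, i, j, hi, hj⟩ := ih (x.length + z.length) (by omega) x z h rfl
    exact ⟨t, i, i + j, hi, by rw [listPow_add, ← hi, ← hj]⟩

/-- A primitive sequence does not commute with any shorter nonempty sequence. -/
theorem Primitive.append_ne_append {α : Type*} {S Y : List α} (hS : Primitive S)
    (hY : Y ≠ []) (hlt : Y.length < S.length) : S ++ Y ≠ Y ++ S := by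
  intro h
  obtain ⟨t, i, j, hi, hj⟩ := exists_listPow_of_append_comm S Y h
  have hi2 : i < 2 := by
    by_contra hi2
    exact hS.2 t i (by omega) hi
  have hYpos := List.length_pos_iff.mpr hY
  rw [hi, hj, length_listPow, length_listPow] at hlt
  rw [hj, length_listPow] at hYpos
  have hj1 : 1 ≤ j := Nat.pos_of_mul_pos_right hYpos
  nlinarith

theorem le_CN_iff {α : Type*} (S : List α) {m : ℕ} (hm : 1 ≤ m) :
    m ≤ CN S ↔ ∃ Y : List α, Y ≠ [] ∧ listPow Y m <:+ S := by
  have hbdd : BddAbove {k | ∃ X Y : List α, Y ≠ [] ∧ S = X ++ listPow Y k} := by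
    refine ⟨S.length, ?_⟩
    rintro k ⟨X, Y, hY, rfl⟩
    have := List.length_pos_iff.mpr hY
    rw [List.length_append, length_listPow]
    nlinarith
  constructor
  · intro h
    have hne : {k | ∃ X Y : List α, Y ≠ [] ∧ S = X ++ listPow Y k}.Nonempty := by
      by_contra hne
      rw [Set.not_nonempty_iff_eq_empty] at hne
      rw [CN, hne, csSup_empty, Nat.bot_eq_zero] at h
      omega
    obtain ⟨X, Y, hY, hS⟩ := Nat.sSup_mem hne hbdd
    exact ⟨Y, hY, (listPow_suffix_listPow Y h).trans ⟨X, hS.symm⟩⟩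
  · rintro ⟨Y, hY, X, hX⟩
    exact le_csSup hbdd ⟨X, Y, hY, hX.symm⟩

/-- If `Y^(k+1)` is a suffix of `S^(k+1)` with `Y` shorter than the primitive sequence `S`,
then already `Y^k` is shorter than `S`. -/
theorem Primitive.mul_length_lt {α : Type*} {S Y : List α} {k : ℕ} (hS : Primitive S)
    (hk : 1 ≤ k) (hY : Y ≠ []) (hlt : Y.length < S.length)
    (hsuf : listPow Y (k + 1) <:+ listPow S (k + 1)) : k * Y.length < S.length := by
  by_contra! hle
  have hSsuf : S <:+ listPow S (k + 1) := by
    simpa only [listPow_one] using listPow_suffix_listPow S (show 1 ≤ k + 1 by omega)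
  have hSY : S <:+ listPow Y k :=
    List.suffix_of_suffix_length_le hSsuf
      ((listPow_suffix_listPow Y (Nat.le_succ k)).trans hsuf) (by rwa [length_listPow])
  have hYS : Y <:+ S := by
    refine List.suffix_of_suffix_length_le ?_ hSsuf hlt.le
    simpa only [listPow_one] using
      (listPow_suffix_listPow Y (show 1 ≤ k + 1 by omega)).trans hsuf
  have h₁ : S ++ Y <:+ listPow S (k + 1) := by
    obtain ⟨U, hU⟩ := hSY
    refine List.IsSuffix.trans ⟨U, ?_⟩ hsuf
    rw [listPow_add, listPow_one, ← hU, List.append_assoc]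
  have h₂ : Y ++ S <:+ listPow S (k + 1) := by
    obtain ⟨V, hV⟩ := hYS
    refine List.IsSuffix.trans ⟨V, ?_⟩
      (listPow_suffix_listPow S (show 1 + 1 ≤ k + 1 by omega))
    rw [listPow_add, listPow_one, ← List.append_assoc, hV]
  have hlen : (S ++ Y).length = (Y ++ S).length := by simp [Nat.add_comm]
  exact hS.append_ne_append hY hlt
    ((List.suffix_of_suffix_length_le h₁ h₂ hlen.le).eq_of_length hlen)

/-- If some nonempty `Y` has `Y^m` as a suffix of `S`, then a shortest such `Y` has
`CN (Y^m) = m`. -/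
theorem exists_listPow_suffix_CN_eq {α : Type*} {S : List α} {m : ℕ} (hm : 1 ≤ m)
    {Y : List α} (hY : Y ≠ []) (hsuf : listPow Y m <:+ S) :
    ∃ Z : List α, Z ≠ [] ∧ Z.length ≤ Y.length ∧ listPow Z m <:+ S ∧
      CN (listPow Z m) = m := by
  induction hn : Y.length using Nat.strong_induction_on generalizing Y with
  | _ n ih =>
    by_cases hCN : CN (listPow Y m) = m
    · exact ⟨Y, hY, hn.le, hsuf, hCN⟩
    have hge : m ≤ CN (listPow Y m) :=
      (le_CN_iff _ hm).mpr ⟨Y, hY, List.suffix_rfl⟩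
    obtain ⟨W, hW, hWsuf⟩ :=
      (le_CN_iff (listPow Y m) (Nat.le_add_left 1 m)).mp (by omega)
    have hWlt : W.length < n := by
      have hlen := hWsuf.length_le
      have hWpos := List.length_pos_iff.mpr hW
      rw [length_listPow, length_listPow, hn] at hlen
      nlinarith
    obtain ⟨Z, hZ, hZle, hZsuf, hZCN⟩ := ih _ hWlt hW
      (((listPow_suffix_listPow W (Nat.le_succ m)).trans hWsuf).trans hsuf) rfl
    exact ⟨Z, hZ, by omega, hZsuf, hZCN⟩

/-- A primitive sequence `S` with curling number `k` is robust if and only if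
no proper suffix of `S^2` has curling number `k + 1`. -/
theorem robust_iff_square {α : Type*} (S : List α) (k : ℕ)
    (hP : Primitive S) (hk : CN S = k) :
    Robust S ↔ ∀ T : List α, ProperSuffix T (listPow S 2) → CN T ≠ k + 1 := by
  have hk1 : 1 ≤ k := by
    rw [← hk, le_CN_iff S le_rfl]
    exact ⟨S, hP.1, by rw [listPow_one]⟩
  have hsq : listPow S 2 <:+ listPow S (k + 1) := listPow_suffix_listPow S (by omega)
  constructor
  · intro hR T hT hCN
    have := hR T (by
      rw [hk]
      exact ⟨hT.1.trans hsq, hT.2.trans_le hsq.length_le⟩)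
    omega
  · intro h T hT
    by_contra! hCN
    rw [hk] at hT hCN
    obtain ⟨Y, hY, hYT⟩ := (le_CN_iff T (Nat.le_add_left 1 k)).mp hCN
    have hYlt : Y.length < S.length := by
      have hlt := hYT.length_le.trans_lt hT.2
      rw [length_listPow, length_listPow] at hlt
      exact lt_of_mul_lt_mul_left hlt (Nat.zero_le _)
    obtain ⟨Z, hZ, hZY, hZsuf, hZCN⟩ :=
      exists_listPow_suffix_CN_eq (Nat.le_add_left 1 k) hY (hYT.trans hT.1)
    have hZlt := hZY.trans_lt hYlt
    have hlen : (listPow Z (k + 1)).length < (listPow S 2).length := by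
      have := hP.mul_length_lt hk1 hZ hZlt hZsuf
      rw [length_listPow, length_listPow, Nat.succ_mul]
      omega
    exact h _ ⟨List.suffix_of_suffix_length_le hZsuf hsq hlen.le, hlen⟩ hZCN
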